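/- arXiv:1304.3029 — 2 statements merged into one kernel-verified Lean document; each statement's English description precedes it below -/
import Mathlib

section
/- Let (y_m) be the Sylvester sequence (y_0 = 2, y_m = 1 + y_0⋯y_{m−1}) and t_m = y_m − 1 (so t_m = y_0⋯y_{m−1}). For n ≥ 2 consider the weights (λ_0,…,λ_n) = (1, 1, t_{n−1}/y_{n−2}, t_{n−1}/y_{n−3}, …, t_{n−1}/y_0), each of which is a positive integer, with sum h = λ_0 + ⋯ + λ_n. Then: (a) h = y_{n−1}; (b) any associated simplex P = conv{ρ_0,…,ρ_n} ⊆ ℚ^n satisfies P ∩ ℤ^n = {ρ_0,…,ρ_n, 0}, i.e. ℙ(1,1,t_{n−1}/y_{n−2},…,t_{n−1}/y_0) is terminal; (c) the degree satisfies h^n/(λ_0λ_1⋯λ_n) = y_{n−1}^n / t_{n−1}^{n−2}; and (d) the δ-vector is shifted palindromic, i.e. with δ_j := #{κ ∈ {0,…,h−1} : Σ_{i=0}^n {λ_i κ / h} = j} one has δ_0 = 1 and δ_j = δ_{n+1−j} for j ∈ {1,…,n}. -/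
/-- The Ehrhart `δ`-vector of the simplex associated with weights `lam` summing to `h`:
`δ_j` counts the `κ ∈ {0,…,h−1}` with `Σᵢ {λᵢκ/h} = j`. -/
def deltaVec (n h : ℕ) (lam : Fin (n + 1) → ℕ) (j : ℕ) : ℕ :=
  ((Finset.range h).filter fun κ : ℕ =>
    (∑ i, Int.fract ((lam i : ℚ) * (κ : ℚ) / (h : ℚ))) = (j : ℚ)).card

section Sylvester

variable {y : ℕ → ℕ}

theorem sylvester_pos (hy0 : y 0 = 2)
    (hyrec : ∀ m : ℕ, y (m + 1) = 1 + ∏ i ∈ Finset.range (m + 1), y i) (m : ℕ) : 0 < y m := by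
  cases m with
  | zero => omega
  | succ m => rw [hyrec]; omega

theorem sylvester_sum_inv (hy0 : y 0 = 2)
    (hyrec : ∀ m : ℕ, y (m + 1) = 1 + ∏ i ∈ Finset.range (m + 1), y i) (m : ℕ) :
    ∑ k ∈ Finset.range (m + 1), (1 / (y k : ℚ))
      = 1 - 1 / ((∏ k ∈ Finset.range (m + 1), y k : ℕ) : ℚ) := by
  induction m with
  | zero => norm_num [hy0]
  | succ m ih =>
    rw [Finset.sum_range_succ, ih, Finset.prod_range_succ _ (m + 1), hyrec m]
    have hP : (0 : ℚ) < ((∏ k ∈ Finset.range (m + 1), y k : ℕ) : ℚ) := by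
      exact_mod_cast Finset.prod_pos fun k _ => sylvester_pos hy0 hyrec k
    push_cast at hP ⊢
    have h1 : (0 : ℚ) < 1 + ∏ k ∈ Finset.range (m + 1), (y k : ℚ) := by linarith
    field_simp
    ring

end Sylvester

/-- Barycentric coordinates of a lattice point are determined modulo `ℤ` by the first one. -/
theorem exists_int_eq_add_mul_of_span_eq_top {n : ℕ} {lam : Fin (n + 1) → ℕ} (hlam : lam 0 = 1)
    {ρ : Fin (n + 1) → Fin n → ℤ} (hspan : Submodule.span ℤ (Set.range ρ) = ⊤)
    (hrel : ∑ i, (lam i : ℤ) • ρ i = 0) (c : Fin (n + 1) → ℚ)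
    (hc : ∀ j, ∃ z : ℤ, ∑ i, c i * (ρ i j : ℚ) = z) :
    ∃ b : Fin (n + 1) → ℤ, ∀ i, c i = b i + c 0 * lam i := by
  choose z hz using hc
  have lift (w : Fin n → ℤ) : ∃ a : Fin (n + 1) → ℤ, ∑ i, a i • ρ i = w :=
    (Submodule.mem_span_range_iff_exists_fun ℤ).1 (hspan ▸ Submodule.mem_top)
  let L : (Fin (n + 1) → ℚ) →ₗ[ℚ] (Fin n → ℚ) :=
    Fintype.linearCombination ℚ fun i j => (ρ i j : ℚ)
  have hL (d : Fin (n + 1) → ℚ) (j : Fin n) : L d j = ∑ i, d i * (ρ i j : ℚ) := by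
    simp [L, Fintype.linearCombination_apply]
  have hLint (a : Fin (n + 1) → ℤ) (j : Fin n) :
      L (fun i => (a i : ℚ)) j = ((∑ i, a i • ρ i) j : ℤ) := by
    simp [hL]
  have hsurj : Function.Surjective L := by
    rw [← LinearMap.range_eq_top, eq_top_iff, ← (Pi.basisFun ℚ (Fin n)).span_eq,
      Submodule.span_le]
    rintro _ ⟨k, rfl⟩
    obtain ⟨a, ha⟩ := lift (Pi.single k 1)
    refine ⟨fun i => (a i : ℚ), funext fun j => ?_⟩
    rw [hLint, ha]
    by_cases hjk : j = k <;> simp [hjk]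
  have hker : Module.finrank ℚ (LinearMap.ker L) = 1 := by
    have := L.finrank_range_add_finrank_ker
    rw [LinearMap.range_eq_top.2 hsurj, finrank_top] at this
    simp at this
    omega
  have hlamker : (fun i => (lam i : ℚ)) ∈ LinearMap.ker L := by
    refine LinearMap.mem_ker.2 (funext fun j => ?_)
    have := hLint (fun i => (lam i : ℤ)) j
    rw [hrel] at this
    simpa using this
  obtain ⟨a, ha⟩ := lift z
  have hdker : (fun i => c i - a i) ∈ LinearMap.ker L := by
    refine LinearMap.mem_ker.2 (funext fun j => ?_)
    have h1 := hLint a j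
    rw [ha, ← hz j, hL] at h1
    rw [hL]
    simp only [sub_mul, Finset.sum_sub_distrib]
    simp [h1]
  obtain ⟨s, hs⟩ := (finrank_eq_one_iff_of_nonzero' (⟨_, hlamker⟩ : LinearMap.ker L) (by
    intro h0
    have := congrFun (congrArg Subtype.val h0) 0
    simp [hlam] at this)).1 hker ⟨_, hdker⟩
  have hs' (i) : s * lam i = c i - a i := congrFun (congrArg Subtype.val hs) i
  refine ⟨fun i => a i - a 0 * lam i, fun i => ?_⟩
  have h0 := hs' 0
  have hi := hs' i
  rw [hlam] at h0
  push_cast at h0 ⊢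
  linear_combination lam i * h0 - hi

/-- Nonnegative integers summing to one form a standard basis vector. -/
theorem exists_eq_single_of_sum_eq_one {ι : Type*} [Fintype ι] [DecidableEq ι] {c : ι → ℚ}
    (hc : ∀ i, ∃ z : ℤ, c i = z) (h0 : ∀ i, 0 ≤ c i) (h1 : ∑ i, c i = 1) :
    ∃ i, c = Pi.single i 1 := by
  choose z hz using hc
  obtain ⟨i, -, hi⟩ := Finset.exists_ne_zero_of_sum_ne_zero (h1.trans_ne one_ne_zero)
  have hge : 1 ≤ c i := by
    have hpos := (h0 i).lt_of_ne' hi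
    rw [hz] at hpos ⊢
    exact_mod_cast hpos
  have hsplit := Finset.add_sum_erase Finset.univ c (Finset.mem_univ i)
  have hrest : 0 ≤ ∑ k ∈ Finset.univ.erase i, c k := Finset.sum_nonneg fun k _ => h0 k
  refine ⟨i, funext fun k => ?_⟩
  by_cases hk : k = i
  · subst hk; simp; linarith
  · have := (Finset.sum_eq_zero_iff_of_nonneg fun k _ => h0 k).1
      (show ∑ k ∈ Finset.univ.erase i, c k = 0 by linarith) k (by simp [hk])
    simp [hk, this]

/-- Barycentric coordinates `c` that are congruent to a multiple of the weights modulo `ℤ`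
are either a vertex or the barycentric coordinates of the origin. -/
theorem eq_single_or_eq_div_of_int_congr {N T : ℕ} (hT : 0 < T) {lam : Fin (N + 3) → ℕ}
    {Y : Fin (N + 1) → ℕ} (hlam0 : lam 0 = 1) (hlam1 : lam 1 = 1)
    (hmul : ∀ j, lam j.succ.succ * Y j = T) (hsum : ∑ i, lam i = T + 1)
    {c : Fin (N + 3) → ℚ} (hc0 : ∀ i, 0 ≤ c i) (hc1 : ∑ i, c i = 1)
    {b : Fin (N + 3) → ℤ} (hb : ∀ i, c i = b i + c 0 * lam i) :
    (∃ i, c = Pi.single i 1) ∨ ∀ i, c i = lam i / (T + 1 : ℚ) := by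
  have hTQ : (0 : ℚ) < T := by exact_mod_cast hT
  have hle (i) : c i ≤ 1 := hc1 ▸ Finset.single_le_sum (fun k _ => hc0 k) (Finset.mem_univ i)
  by_cases hu0 : c 0 = 0
  · exact .inl (exists_eq_single_of_sum_eq_one (fun i => ⟨b i, by rw [hb, hu0]; ring⟩) hc0 hc1)
  by_cases hu1 : c 0 = 1
  · refine .inl (exists_eq_single_of_sum_eq_one (fun i => ⟨b i + lam i, ?_⟩) hc0 hc1)
    rw [hb, hu1]; push_cast; ring
  right
  have hu0' : 0 < c 0 := (hc0 0).lt_of_ne' hu0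
  have hu1' : c 0 < 1 := (hle 0).lt_of_ne hu1
  have hsumQ : ∑ i, (lam i : ℚ) = T + 1 := by exact_mod_cast hsum
  have hκint : c 0 * (T + 1) = ((1 - ∑ i, b i : ℤ) : ℚ) := by
    rw [← hsumQ, Finset.mul_sum]
    push_cast
    rw [← hc1, ← Finset.sum_sub_distrib]
    exact Finset.sum_congr rfl fun i _ => by linarith [hb i]
  have hκ : 1 ≤ c 0 * (T + 1) := by
    have hpos : 0 < c 0 * (T + 1) := by positivity
    rw [hκint] at hpos ⊢
    exact_mod_cast hpos
  have hc1eq : c 1 = c 0 := by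
    have h1 := hb 1
    rw [hlam1] at h1
    have hlt : (b 1 : ℚ) < 1 := by push_cast at h1; linarith [hle 1]
    have hgt : (-1 : ℚ) < b 1 := by push_cast at h1; linarith [hc0 1]
    have : b 1 = 0 := by
      have h2 : b 1 < 1 := by exact_mod_cast hlt
      have h3 : -1 < b 1 := by exact_mod_cast hgt
      omega
    rw [h1, this]; simp
  have hlow (j) : (1 - c 0) * lam (Fin.succ (Fin.succ j)) ≤ T * c j.succ.succ := by
    have hm : (lam j.succ.succ : ℚ) * Y j = T := by exact_mod_cast hmul j
    have hint : Y j * c j.succ.succ + c 0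
        = ((Y j * b j.succ.succ : ℤ) : ℚ) + c 0 * (T + 1) := by
      rw [hb j.succ.succ, ← hm]; push_cast; ring
    rw [hκint, ← Int.cast_add] at hint
    have hpos : 0 < Y j * c j.succ.succ + c 0 :=
      add_pos_of_nonneg_of_pos (mul_nonneg (by positivity) (hc0 _)) hu0'
    have hge : 1 ≤ Y j * c j.succ.succ + c 0 := by
      rw [hint] at hpos ⊢
      exact_mod_cast hpos
    rw [← hm]
    nlinarith [mul_le_mul_of_nonneg_left hge (Nat.cast_nonneg (α := ℚ) (lam j.succ.succ))]
  have hsumc := hc1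
  have hsuml := hsumQ
  rw [Fin.sum_univ_succ, Fin.sum_univ_succ] at hsumc hsuml
  simp only [Fin.succ_zero_eq_one, hc1eq, hlam0, hlam1, Nat.cast_one] at hsumc hsuml
  have hsumlow := Finset.sum_le_sum fun j (_ : j ∈ Finset.univ) => hlow j
  rw [← Finset.mul_sum, ← Finset.mul_sum] at hsumlow
  have hS : ∑ j : Fin (N + 1), (lam j.succ.succ : ℚ) = T - 1 := by linarith
  have hC : ∑ j : Fin (N + 1), c j.succ.succ = 1 - 2 * c 0 := by linarith
  rw [hS, hC] at hsumlow
  have hu : c 0 * (T + 1) = 1 := by linarith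
  have hge : ∀ i ∈ Finset.univ, (lam i : ℚ) / (T + 1) ≤ c i := by
    intro i _
    rw [div_le_iff₀ (by positivity)]
    refine Fin.cases ?_ (fun i => Fin.cases ?_ (fun j => ?_) i) i
    · rw [hlam0]; push_cast; linarith
    · rw [Fin.succ_zero_eq_one, hlam1, hc1eq]; push_cast; linarith
    · have h1 : (1 - c 0) * (T + 1) = T := by linarith
      have h2 := mul_le_mul_of_nonneg_right (hlow j) (show (0 : ℚ) ≤ T + 1 by positivity)
      have h3 : T * (lam j.succ.succ : ℚ) ≤ T * (c j.succ.succ * (T + 1)) := by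
        linear_combination h2 - lam j.succ.succ * h1
      exact le_of_mul_le_mul_left h3 hTQ
  have heq := (Finset.sum_eq_sum_iff_of_le hge).1 (by
    rw [← Finset.sum_div, hsumQ, hc1, div_self (by positivity)])
  exact fun i => (heq i (Finset.mem_univ i)).symm

/-- The simplex associated with such weights has no lattice points besides its vertices
and the origin. -/
theorem latticePoints_convexHull {N T : ℕ} (hT : 0 < T) {lam : Fin (N + 3) → ℕ}
    {Y : Fin (N + 1) → ℕ} (hlam0 : lam 0 = 1) (hlam1 : lam 1 = 1)
    (hmul : ∀ j, lam j.succ.succ * Y j = T) (hsum : ∑ i, lam i = T + 1)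
    {ρ : Fin (N + 3) → Fin (N + 2) → ℤ} (hspan : Submodule.span ℤ (Set.range ρ) = ⊤)
    (hrel : ∑ i, (lam i : ℤ) • ρ i = 0) :
    {x : Fin (N + 2) → ℚ | x ∈ convexHull ℚ (Set.range fun i => fun j => (ρ i j : ℚ)) ∧
        ∀ j, ∃ z : ℤ, x j = (z : ℚ)}
      = Set.range (fun i => fun j => (ρ i j : ℚ)) ∪ {0} := by
  have hrelQ (j) : ∑ i, (lam i : ℚ) * (ρ i j : ℚ) = 0 := by
    have := congrFun hrel j
    simp at this
    exact_mod_cast this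
  have hsumQ : ∑ i, (lam i : ℚ) = T + 1 := by exact_mod_cast hsum
  have hzero (j) : ∑ i, (lam i / (T + 1 : ℚ)) * (ρ i j : ℚ) = 0 := by
    simp only [div_mul_eq_mul_div, ← Finset.sum_div, hrelQ, zero_div]
  ext x
  simp only [Set.mem_ofPred_eq, Set.mem_union, Set.mem_singleton_iff]
  constructor
  · rintro ⟨hx, hint⟩
    rw [convexHull_range_eq_exists_affineCombination] at hx
    obtain ⟨s, w, hw0, hw1, rfl⟩ := hx
    rw [s.affineCombination_eq_linear_combination _ w hw1] at hint ⊢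
    obtain ⟨c, hc⟩ : ∃ c : Fin (N + 3) → ℚ, c = fun i => if i ∈ s then w i else 0 := ⟨_, rfl⟩
    have hx : ∑ i ∈ s, w i • (fun j => (ρ i j : ℚ)) = fun j => ∑ i, c i * (ρ i j : ℚ) := by
      ext j; simp [hc, ite_mul]
    rw [hx] at hint ⊢
    have hc0 (i) : 0 ≤ c i := by
      simp only [hc]; split_ifs with hi
      exacts [hw0 i hi, le_rfl]
    have hc1 : ∑ i, c i = 1 := by simpa [hc] using hw1
    obtain ⟨b, hb⟩ := exists_int_eq_add_mul_of_span_eq_top hlam0 hspan hrel c hint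
    rcases eq_single_or_eq_div_of_int_congr hT hlam0 hlam1 hmul hsum hc0 hc1 hb with
      ⟨i, hi⟩ | hi
    · left
      refine ⟨i, ?_⟩
      ext j
      simp [hi, Pi.single_apply]
    · right
      ext j
      simpa [hi] using hzero j
  · rintro (⟨i, rfl⟩ | rfl)
    · exact ⟨subset_convexHull _ _ ⟨i, rfl⟩, fun j => ⟨ρ i j, rfl⟩⟩
    · refine ⟨?_, fun j => ⟨0, by simp⟩⟩
      have := (convex_convexHull ℚ (Set.range fun i => fun j => (ρ i j : ℚ))).sum_mem
        (t := Finset.univ) (w := fun i => (lam i / (T + 1 : ℚ)))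
        (z := fun i => fun j => (ρ i j : ℚ)) (fun i _ => by positivity)
        (by rw [← Finset.sum_div, hsumQ, div_self (by positivity)])
        (fun i _ => subset_convexHull _ _ ⟨i, rfl⟩)
      convert this using 1
      ext j
      simpa using (hzero j).symm

theorem sum_fract_eq_zero_iff {n h : ℕ} {lam : Fin (n + 1) → ℕ} (hlam0 : lam 0 = 1) {κ : ℕ}
    (hκ : κ < h) : ∑ i, Int.fract ((lam i : ℚ) * (κ : ℚ) / (h : ℚ)) = 0 ↔ κ = 0 := by
  have hh : (0 : ℚ) < h := by exact_mod_cast (by omega : 0 < h)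
  constructor
  · intro hs
    have := (Finset.sum_eq_zero_iff_of_nonneg fun i _ => Int.fract_nonneg _).1 hs 0
      (Finset.mem_univ _)
    rw [hlam0, Nat.cast_one, one_mul, Int.fract_eq_self.2 ⟨by positivity,
      (div_lt_one hh).2 (by exact_mod_cast hκ)⟩] at this
    have h0 := (div_eq_zero_iff.1 this).resolve_right hh.ne'
    exact_mod_cast h0
  · rintro rfl; simp

theorem deltaVec_zero {n h : ℕ} {lam : Fin (n + 1) → ℕ} (hh : 0 < h) (hlam0 : lam 0 = 1) :
    deltaVec n h lam 0 = 1 := by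
  rw [deltaVec, Finset.card_eq_one]
  refine ⟨0, Finset.ext fun κ => ?_⟩
  simp only [Finset.mem_filter, Finset.mem_range, Finset.mem_singleton, Nat.cast_zero]
  constructor
  · rintro ⟨hκ, hs⟩
    exact (sum_fract_eq_zero_iff hlam0 hκ).1 hs
  · rintro rfl
    exact ⟨hh, (sum_fract_eq_zero_iff hlam0 hh).2 rfl⟩

theorem sum_fract_add_sum_fract_sub {n h : ℕ} {lam : Fin (n + 1) → ℕ}
    (hcop : ∀ i, (lam i).Coprime h) {κ : ℕ} (hκ0 : 0 < κ) (hκ : κ < h) :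
    ∑ i, Int.fract ((lam i : ℚ) * ((h - κ : ℕ) : ℚ) / (h : ℚ))
      = (n + 1 : ℕ) - ∑ i, Int.fract ((lam i : ℚ) * (κ : ℚ) / (h : ℚ)) := by
  have hh : (h : ℚ) ≠ 0 := by exact_mod_cast (by omega : h ≠ 0)
  have key (i) : Int.fract ((lam i : ℚ) * ((h - κ : ℕ) : ℚ) / (h : ℚ))
      = 1 - Int.fract ((lam i : ℚ) * (κ : ℚ) / (h : ℚ)) := by
    rw [Nat.cast_sub hκ.le, show (lam i : ℚ) * ((h : ℚ) - κ) / h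
      = -((lam i : ℚ) * (κ : ℚ) / (h : ℚ)) + lam i by field_simp; ring, Int.fract_add_natCast,
      Int.fract_neg]
    intro h0
    obtain ⟨z, hz⟩ := Int.fract_eq_zero_iff.1 h0
    rw [eq_div_iff hh] at hz
    have hdvd : (h : ℤ) ∣ (lam i : ℤ) * κ := ⟨z, by rw [mul_comm (h : ℤ)]; exact_mod_cast hz.symm⟩
    have := (hcop i).symm.dvd_of_dvd_mul_left (by exact_mod_cast hdvd)
    exact absurd (Nat.le_of_dvd hκ0 this) (by omega)
  simp [key, Finset.sum_sub_distrib]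

theorem deltaVec_eq_deltaVec_sub {n h : ℕ} {lam : Fin (n + 1) → ℕ} (hlam0 : lam 0 = 1)
    (hcop : ∀ i, (lam i).Coprime h) {j : ℕ} (hj1 : 1 ≤ j) (hjn : j ≤ n) :
    deltaVec n h lam j = deltaVec n h lam (n + 1 - j) := by
  have maps {j κ : ℕ} (hj1 : 1 ≤ j) (hjn : j ≤ n + 1)
      (hκ : κ < h ∧ ∑ i, Int.fract ((lam i : ℚ) * (κ : ℚ) / (h : ℚ)) = j) :
      0 < κ ∧ h - κ < h ∧ ∑ i, Int.fract ((lam i : ℚ) * ((h - κ : ℕ) : ℚ) / (h : ℚ))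
        = ((n + 1 - j : ℕ) : ℚ) := by
    have hpos : 0 < κ := by
      by_contra hκ0
      have := hκ.2.symm.trans ((sum_fract_eq_zero_iff hlam0 hκ.1).2 (by omega))
      have : j = 0 := by exact_mod_cast this
      omega
    refine ⟨hpos, by omega, ?_⟩
    rw [sum_fract_add_sum_fract_sub hcop hpos hκ.1, hκ.2, Nat.cast_sub hjn]
  refine Finset.card_nbij' (fun κ => h - κ) (fun κ => h - κ) ?_ ?_ ?_ ?_
  · intro κ hκ
    simp only [Finset.coe_filter, Finset.mem_range, Set.mem_ofPred_eq] at hκ ⊢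
    exact (maps hj1 (by omega) hκ).2
  · intro κ hκ
    simp only [Finset.coe_filter, Finset.mem_range, Set.mem_ofPred_eq] at hκ ⊢
    have := (maps (by omega) (by omega) hκ).2
    rwa [show n + 1 - (n + 1 - j) = j by omega] at this
  · intro κ hκ
    simp only [Finset.coe_filter, Finset.mem_range, Set.mem_ofPred_eq] at hκ
    show h - (h - κ) = κ
    omega
  · intro κ hκ
    simp only [Finset.coe_filter, Finset.mem_range, Set.mem_ofPred_eq] at hκ
    show h - (h - κ) = κ
    omega

/-- **Lemma 3.5.** Let `y` be the Sylvester sequence (`y₀ = 2`, `y_m = 1 + y₀⋯y_{m−1}`)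
and `t_m = y_m − 1`. For `n ≥ 2`, the weights `(1, 1, t_{n−1}/y_{n−2}, …, t_{n−1}/y₀)`
are positive integers summing to `h = y_{n−1}`; the corresponding weighted projective
space is terminal, has degree `hⁿ/(λ₀⋯λₙ) = y_{n−1}ⁿ/t_{n−1}^{n−2}`, and its associated
simplex has shifted palindromic `δ`-vector. -/
theorem stmt_5 (n : ℕ) (hn : 2 ≤ n)
    (y t : ℕ → ℕ)
    (hy0 : y 0 = 2)
    (hyrec : ∀ m : ℕ, y (m + 1) = 1 + ∏ i ∈ Finset.range (m + 1), y i)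
    (ht : ∀ m : ℕ, t m = y m - 1)
    (lam : Fin (n + 1) → ℕ)
    (hlam : ∀ i : Fin (n + 1),
      lam i = if (i : ℕ) < 2 then 1 else t (n - 1) / y (n - (i : ℕ)))
    (h : ℕ) (hh : h = ∑ i, lam i) :
    (∀ i : Fin (n + 1), 2 ≤ (i : ℕ) → y (n - (i : ℕ)) ∣ t (n - 1)) ∧
    h = y (n - 1) ∧
    (∀ ρ : Fin (n + 1) → Fin n → ℤ,
      (∀ i, Finset.univ.gcd (ρ i) = 1) →
      Submodule.span ℤ (Set.range ρ) = ⊤ →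
      (∑ i, (lam i : ℤ) • ρ i) = 0 →
      {x : Fin n → ℚ |
          x ∈ convexHull ℚ (Set.range fun i => fun j => (ρ i j : ℚ)) ∧
          ∀ j, ∃ z : ℤ, x j = (z : ℚ)}
        = Set.range (fun i => fun j => (ρ i j : ℚ)) ∪ {0}) ∧
    (h : ℚ) ^ n / (∏ i, (lam i : ℚ))
      = (y (n - 1) : ℚ) ^ n / (t (n - 1) : ℚ) ^ (n - 2) ∧
    deltaVec n h lam 0 = 1 ∧
    (∀ j : ℕ, 1 ≤ j → j ≤ n → deltaVec n h lam j = deltaVec n h lam (n + 1 - j)) := by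
  obtain ⟨N, rfl⟩ : ∃ N, n = N + 2 := ⟨n - 2, by omega⟩
  have hypos := sylvester_pos hy0 hyrec
  have hyposQ (k) : (0 : ℚ) < y k := by exact_mod_cast hypos k
  obtain ⟨T, hTdef⟩ : ∃ T, T = ∏ k ∈ Finset.range (N + 1), y k := ⟨_, rfl⟩
  have hT : 0 < T := hTdef ▸ Finset.prod_pos fun k _ => hypos k
  have hTQ : (0 : ℚ) < T := by exact_mod_cast hT
  have hyN : y (N + 2 - 1) = T + 1 := by
    rw [show N + 2 - 1 = N + 1 by omega, hyrec, hTdef, add_comm]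
  have htN : t (N + 2 - 1) = T := by rw [ht, hyN]; omega
  have hdvd (k : ℕ) (hk : k < N + 1) : y k ∣ T :=
    hTdef ▸ Finset.dvd_prod_of_mem y (Finset.mem_range.2 hk)
  have hlam0 : lam 0 = 1 := by simp [hlam]
  have hlam1 : lam 1 = 1 := by simp [hlam]
  have hmul (j : Fin (N + 1)) : lam j.succ.succ * y (N - j) = T := by
    rw [hlam, if_neg (by simp), htN,
      show N + 2 - ((j.succ.succ : Fin (N + 3)) : ℕ) = N - j by simp]
    exact Nat.div_mul_cancel (hdvd _ (by omega))
  have hlamQ (j : Fin (N + 1)) : (lam j.succ.succ : ℚ) = T / y (N - j) := by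
    rw [eq_div_iff (hyposQ _).ne']
    exact_mod_cast hmul j
  have hsum : ∑ i, lam i = T + 1 := by
    have hrefl : ∑ j : Fin (N + 1), (1 / (y (N - j) : ℚ)) = 1 - 1 / (T : ℚ) := by
      rw [hTdef, ← sylvester_sum_inv hy0 hyrec N, ← Finset.sum_range_reflect,
        Finset.sum_range fun j => (1 / (y (N + 1 - 1 - j) : ℚ))]
      simp
    have : ∑ i, (lam i : ℚ) = T + 1 := by
      rw [Fin.sum_univ_succ, Fin.sum_univ_succ, Fin.succ_zero_eq_one, hlam0, hlam1]
      simp only [hlamQ, div_eq_mul_one_div (T : ℚ)]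
      rw [← Finset.mul_sum, hrefl]
      field_simp
      push_cast
      ring
    exact_mod_cast this
  have hh' : h = T + 1 := hh.trans hsum
  have hprod : ∏ i, (lam i : ℚ) = (T : ℚ) ^ N := by
    have hrefl : ∏ j : Fin (N + 1), (y (N - j) : ℚ) = T := by
      rw [hTdef, ← Finset.prod_range_reflect, Finset.prod_range fun j => y (N + 1 - 1 - j)]
      simp
    rw [Fin.prod_univ_succ, Fin.prod_univ_succ, Fin.succ_zero_eq_one, hlam0, hlam1]
    simp only [hlamQ]
    rw [Finset.prod_div_distrib, hrefl, Finset.prod_const, Finset.card_univ, Fintype.card_fin]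
    field_simp
    simp [pow_succ']
  have hcop (i) : (lam i).Coprime h := by
    have hiT : lam i ∣ T := by
      refine Fin.cases ?_ (fun i => Fin.cases ?_ (fun j => ?_) i) i
      · simp [hlam0]
      · simp [hlam1]
      · exact ⟨_, (hmul j).symm⟩
    rw [hh']
    exact Nat.Coprime.coprime_dvd_left hiT (by simp)
  refine ⟨fun i hi => htN ▸ hdvd _ (by omega), hh'.trans hyN.symm,
    fun ρ _ hspan hrel => latticePoints_convexHull hT hlam0 hlam1 hmul hsum hspan hrel,
    ?_, deltaVec_zero (by omega) hlam0, fun j => deltaVec_eq_deltaVec_sub hlam0 hcop⟩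
  rw [hprod, hh', hyN, htN, Nat.add_sub_cancel]
end

section
/- Let (λ_0,…,λ_6) be a well-formed tuple of positive integers with gcd equal to 1 and h = λ_0 + ⋯ + λ_6, such that λ_i ∣ h for every i, and such that for every integer κ with 2 ≤ κ ≤ h − 2 one has 2 ≤ Σ_{i=0}^6 {λ_i κ / h} ≤ 5 (i.e. the Gorenstein weighted projective space ℙ(λ_0,…,λ_6) is terminal). Then, up to permutation, (λ_0,…,λ_6) equals one of the following eighteen tuples: (1,1,1,1,1,1,1), (1,1,1,1,1,1,2), (1,1,1,1,1,1,3), (1,1,1,1,2,2,2), (1,1,1,1,1,3,4), (1,1,1,1,2,2,4), (1,1,1,1,2,3,3), (1,1,1,2,2,2,3), (1,1,1,1,3,3,5), (1,1,2,2,3,3,6), (1,1,2,2,4,5,5), (1,1,1,3,4,6,8), (1,1,2,3,3,6,8), (1,1,3,3,4,4,8), (1,2,3,3,3,4,8), (1,2,3,3,5,6,10), (2,2,3,3,5,5,10), (1,3,4,5,12,15,20). -/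
/-- The eighteen weight tuples, in increasing order of degree. -/
def terminalWeights : List (Fin 7 → ℕ) := [
  ![1, 1, 1, 1, 1, 1, 1], ![1, 1, 1, 1, 1, 1, 2], ![1, 1, 1, 1, 1, 1, 3],
  ![1, 1, 1, 1, 2, 2, 2], ![1, 1, 1, 1, 1, 3, 4], ![1, 1, 1, 1, 2, 2, 4],
  ![1, 1, 1, 1, 2, 3, 3], ![1, 1, 1, 2, 2, 2, 3], ![1, 1, 1, 1, 3, 3, 5],
  ![1, 1, 2, 2, 3, 3, 6], ![1, 1, 2, 2, 4, 5, 5], ![1, 1, 1, 3, 4, 6, 8],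
  ![1, 1, 2, 3, 3, 6, 8], ![1, 1, 3, 3, 4, 4, 8], ![1, 2, 3, 3, 3, 4, 8],
  ![1, 2, 3, 3, 5, 6, 10], ![2, 2, 3, 3, 5, 5, 10], ![1, 3, 4, 5, 12, 15, 20]]

/-- `∑ ⌊k / a⌋` over the entries `a` of `S`. -/
def floorSum (k : ℕ) (S : List ℕ) : ℕ := S.rec 0 fun a _ s => k / a + s

/-- Some `k` in the window `[2, K + 2)` with `k + 2 ≤ L` violates the lower terminality bound
already for the partial list `S`. -/
def violates (K : ℕ) (S : List ℕ) (L : ℕ) : Bool :=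
  (List.range' 2 K).any fun k => (k + 2).ble L && k.blt (floorSum k S + 2)

/-- An upper bound for the smallest entry, known to be between `lo` and `ub`, that can be
added to `S`: a `j` smaller than all remaining entries has to satisfy the upper terminality
bound on `S` alone. -/
def nextBound (S : List ℕ) (lo ub : ℕ) : ℕ :=
  match (List.range' lo (ub - lo)).find? fun j => (floorSum j S + 4).blt j with
  | none => ub
  | some j => min ub (j + 2)

/-- `search m S L p` explores all ways of adding `m` further denominators, in increasing order
and with reciprocals summing to `p / L`, to the decreasing list `S` of divisors of `L`, and
checks that each of them violates terminality or gives one of the `terminalWeights`. -/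
def search : ℕ → List ℕ → ℕ → ℕ → Bool
  | 0, S, L, _ => violates 200 S L || decide (S.map (L / ·) ∈ terminalWeights.map List.ofFn)
  | m + 1, S, L, p =>
    let lo := max (S.headD 1) ((L + p - 1) / p)
    let ub := (m + 1) * L / p
    ub.blt lo || (m != 0 && violates 20 S L) ||
      (List.range' lo (nextBound S lo ub + 1 - lo)).all fun b =>
        let L' := L.lcm b
        search m (b :: S) L' (p * (L' / L) - L' / b)

set_option maxRecDepth 100000 in
theorem search_eq_true : search 7 [] 1 1 = true := by decide +kernel

/-- The terminality conditions for the list `A` of the quotients `h / λ_i`. -/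
structure IsTerminalList (h : ℕ) (A : List ℕ) : Prop where
  h_pos : 0 < h
  dvd : ∀ a ∈ A, a ∣ h
  floorSum_le : ∀ k, 2 ≤ k → k + 2 ≤ h → floorSum k A + 2 ≤ k
  le_floorSum : ∀ j, j + 3 ≤ h → j ≤ floorSum j A + 4

theorem floorSum_eq_sum (k : ℕ) (S : List ℕ) : floorSum k S = (S.map (k / ·)).sum := by
  induction S with
  | nil => rfl
  | cons a S ih => rw [List.map_cons, List.sum_cons, ← ih]; rfl

theorem floorSum_reverse_append (k : ℕ) (T S : List ℕ) :
    floorSum k (T.reverse ++ S) = floorSum k T + floorSum k S := by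
  simp [floorSum_eq_sum, List.sum_reverse]

theorem floorSum_eq_zero {k : ℕ} {S : List ℕ} (hS : ∀ a ∈ S, k < a) : floorSum k S = 0 := by
  induction S with
  | nil => rfl
  | cons a S ih =>
    simp only [List.mem_cons, forall_eq_or_imp] at hS
    change k / a + floorSum k S = 0
    rw [ih hS.2, Nat.div_eq_of_lt hS.1]

theorem floorSum_le_length_mul {k b : ℕ} {S : List ℕ} (hb : 0 < b) (hS : ∀ a ∈ S, b ≤ a) :
    floorSum k S ≤ S.length * (k / b) := by
  induction S with
  | nil => exact Nat.zero_le _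
  | cons a S ih =>
    simp only [List.mem_cons, forall_eq_or_imp] at hS
    have h₁ := ih hS.2
    have h₂ : k / a ≤ k / b := Nat.div_le_div_left hS.1 hb
    change k / a + floorSum k S ≤ (S.length + 1) * (k / b)
    linarith

/-- The reflection `k ↦ h - k` exchanges rounding down and rounding up. -/
theorem floorSum_sub_succ {h j : ℕ} {A : List ℕ} (hA : ∀ a ∈ A, a ∣ h) (hj : j < h) :
    floorSum (h - (j + 1)) A + A.length + floorSum j A = floorSum h A := by
  induction A with
  | nil => rfl
  | cons a A ih =>
    simp only [List.mem_cons, forall_eq_or_imp] at hA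
    obtain ⟨⟨q, rfl⟩, hA⟩ := hA
    have hq := Nat.mul_sub_div j a q hj
    have ha : 0 < a := Nat.pos_of_ne_zero (by rintro rfl; simp at hj)
    have hlt : j / a < q := (Nat.div_lt_iff_lt_mul ha).2 (by linarith)
    have hd : a * q / a = q := Nat.mul_div_cancel_left q ha
    have := ih hA
    change (a * q - (j + 1)) / a + floorSum (a * q - (j + 1)) A + (A.length + 1) +
      (j / a + floorSum j A) = a * q / a + floorSum (a * q) A
    rw [hd, hq]
    omega

theorem not_violates {h K L : ℕ} {S T : List ℕ} (hA : IsTerminalList h (T.reverse ++ S))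
    (hL : L ∣ h) : violates K S L = false := by
  rw [violates, List.any_eq_false]
  intro k hk
  simp only [Bool.and_eq_true, Nat.ble_eq, Nat.blt_eq, not_and, not_lt]
  intro hkL
  have := hA.floorSum_le k (by simp at hk; omega) (hkL.trans (Nat.le_of_dvd hA.h_pos hL))
  rw [floorSum_reverse_append] at this
  omega

theorem le_nextBound {h b lo ub : ℕ} {S T : List ℕ}
    (hA : IsTerminalList h ((b :: T).reverse ++ S)) (hT : ∀ a ∈ T, b ≤ a) (hub : b ≤ ub) :
    b ≤ nextBound S lo ub := by
  rw [nextBound]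
  split
  · exact hub
  · rename_i j hj
    have hj := List.find?_some hj
    simp only [Nat.blt_eq] at hj
    refine le_min hub ?_
    by_contra! hlt
    have hbh : b ≤ h := Nat.le_of_dvd hA.h_pos (hA.dvd b (by simp))
    have := hA.le_floorSum j (by omega)
    rw [floorSum_reverse_append, floorSum_eq_zero] at this
    · omega
    · simp only [List.mem_cons, forall_eq_or_imp]
      exact ⟨by omega, fun a ha => by have := hT a ha; omega⟩

theorem search_sound {h : ℕ} (T : List ℕ) : ∀ (S : List ℕ) (L p : ℕ),
    IsTerminalList h (T.reverse ++ S) → L ∣ h → (∀ a ∈ S, a ∣ L) → T.Pairwise (· ≤ ·) →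
    (∀ b ∈ T, S.headD 1 ≤ b) → L * floorSum h T = p * h → search T.length S L p = true →
    ∃ M, M ∣ h ∧ (∀ a ∈ T.reverse ++ S, a ∣ M) ∧
      (T.reverse ++ S).map (M / ·) ∈ terminalWeights.map List.ofFn := by
  induction T with
  | nil =>
    intro S L p hA hL hS _ _ _ hs
    rw [List.length_nil, search, not_violates hA hL, Bool.false_or, decide_eq_true_eq] at hs
    exact ⟨L, hL, hS, hs⟩
  | cons b T ih =>
    intro S L p hA hL hS hT hhead hsum hs
    obtain ⟨hbT, hT⟩ := List.pairwise_cons.1 hT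
    have hh := hA.h_pos
    have hbh : b ∣ h := hA.dvd b (by simp)
    have hb : 0 < b := Nat.pos_of_dvd_of_pos hbh hh
    have hLpos : 0 < L := Nat.pos_of_dvd_of_pos hL hh
    have hcons : floorSum h (b :: T) = h / b + floorSum h T := rfl
    have hdiv : h / b * b = h := Nat.div_mul_cancel hbh
    have hqpos : 0 < h / b := Nat.div_pos (Nat.le_of_dvd hh hbh) hb
    have hLpb : L ≤ p * b := by
      have : L * (h / b) ≤ p * b * (h / b) := by
        calc L * (h / b) ≤ L * floorSum h (b :: T) := by gcongr; omega
          _ = p * (h / b * b) := by rw [hsum, hdiv]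
          _ = _ := by ring
      exact Nat.le_of_mul_le_mul_right this hqpos
    have hp : 0 < p := Nat.pos_of_ne_zero (by rintro rfl; omega)
    have hpbL : b * p ≤ (T.length + 1) * L := by
      have hle := floorSum_le_length_mul (k := h) (S := b :: T) hb (by simpa using hbT)
      have : b * p * (h / b) ≤ (T.length + 1) * L * (h / b) := by
        calc b * p * (h / b) = p * (h / b * b) := by ring
          _ = L * floorSum h (b :: T) := by rw [hsum, hdiv]
          _ ≤ L * ((b :: T).length * (h / b)) := by gcongr
          _ = _ := by rw [List.length_cons]; ring
      exact Nat.le_of_mul_le_mul_right this hqpos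
    have hub : b ≤ (T.length + 1) * L / p := (Nat.le_div_iff_mul_le hp).2 hpbL
    have hlo : max (S.headD 1) ((L + p - 1) / p) ≤ b := by
      refine max_le (hhead b (by simp)) (Nat.le_of_lt_succ ((Nat.div_lt_iff_lt_mul hp).2 ?_))
      rw [Nat.succ_mul, mul_comm b]
      omega
    rw [List.length_cons, search] at hs
    simp only [not_violates hA hL, Bool.and_false, Bool.or_false, Bool.or_eq_true, Nat.blt_eq,
      not_lt_of_ge (hlo.trans hub), false_or, List.all_eq_true] at hs
    have hnext := hs b (by
      have := le_nextBound (lo := max (S.headD 1) ((L + p - 1) / p)) hA hbT hub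
      rw [List.mem_range'_1]
      omega)
    have hbL := Nat.dvd_lcm_right L b
    have hLL := Nat.dvd_lcm_left L b
    have hrev : (b :: T).reverse ++ S = T.reverse ++ b :: S := by simp
    rw [hrev] at hA ⊢
    refine ih (b :: S) (L.lcm b) _ hA (Nat.lcm_dvd hL hbh) ?_ hT hbT ?_ hnext
    · simpa using ⟨hbL, fun a ha => (hS a ha).trans hLL⟩
    · obtain ⟨c, hc⟩ := hLL
      obtain ⟨d, hd⟩ := hbL
      have hc' : L.lcm b / L = c := by rw [hc, Nat.mul_div_cancel_left _ hLpos]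
      have hd' : L.lcm b / b = d := by rw [hd, Nat.mul_div_cancel_left _ hb]
      rw [hc', hd', Nat.sub_mul]
      have h₁ : L.lcm b * (h / b) = d * h := by
        rw [hd, ← hdiv, Nat.mul_div_cancel _ hb]; ring
      have h₂ : L.lcm b * (h / b + floorSum h T) = p * c * h := by
        rw [hc, ← hcons, mul_right_comm, hsum]; ring
      rw [mul_add] at h₂
      omega

/-- The floor sum of the quotients `h / λ_i`, in terms of the fractional parts of `λ_i k / h`. -/
theorem sum_fract_add_sum_div {ι : Type*} [Fintype ι] {lam : ι → ℕ} {h : ℕ} (hh : h = ∑ i, lam i)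
    (hpos : 0 < h) (hdvd : ∀ i, lam i ∣ h) (k : ℕ) :
    ∑ i, Int.fract ((lam i : ℚ) * ((k : ℤ) : ℚ) / (h : ℚ)) +
      ((∑ i, k / (h / lam i) : ℕ) : ℚ) = k := by
  have hterm (i : ι) : Int.fract ((lam i : ℚ) * ((k : ℤ) : ℚ) / (h : ℚ)) +
      ((k / (h / lam i) : ℕ) : ℚ) = (lam i : ℚ) * k / h := by
    obtain ⟨q, hq⟩ := hdvd i
    have hl : 0 < lam i := Nat.pos_of_ne_zero (by intro h0; simp [h0] at hq; omega)
    have hq' : h / lam i = q := by rw [hq, Nat.mul_div_cancel_left _ hl]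
    have hx : (lam i : ℚ) * k / h = (k : ℚ) / q := by
      rw [hq, Nat.cast_mul, mul_div_mul_left _ _ (by positivity)]
    rw [hq', Int.cast_natCast, hx, Int.fract, Rat.floor_natCast_div_natCast,
      ← Int.natCast_ediv, Int.cast_natCast, sub_add_cancel]
  have hne : (h : ℚ) ≠ 0 := by positivity
  rw [Nat.cast_sum, ← Finset.sum_add_distrib, Finset.sum_congr rfl fun i _ => hterm i,
    ← Finset.sum_div, ← Finset.sum_mul, ← Nat.cast_sum, ← hh]
  field_simp

/-- **Theorem 5.4.** A six-dimensional terminal Gorenstein weighted projective space has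
weights, up to permutation, one of the eighteen tuples of Table 4. -/
theorem stmt_12 (lam : Fin 7 → ℕ)
    (hpos : ∀ i, 0 < lam i)
    (hgcd : Finset.univ.gcd lam = 1)
    (hwf : ∀ i : Fin 7, (Finset.univ.erase i).gcd lam = 1)
    (h : ℕ) (hh : h = ∑ i, lam i)
    (hdvd : ∀ i, lam i ∣ h)
    (hterm : ∀ κ : ℤ, 2 ≤ κ → κ ≤ (h : ℤ) - 2 →
      2 ≤ ∑ i, Int.fract ((lam i : ℚ) * (κ : ℚ) / (h : ℚ)) ∧
        ∑ i, Int.fract ((lam i : ℚ) * (κ : ℚ) / (h : ℚ)) ≤ 5) :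
    ∃ σ : Equiv.Perm (Fin 7),
      (fun i => lam (σ i)) ∈ [
        ![1, 1, 1, 1, 1, 1, 1], ![1, 1, 1, 1, 1, 1, 2], ![1, 1, 1, 1, 1, 1, 3],
        ![1, 1, 1, 1, 2, 2, 2], ![1, 1, 1, 1, 1, 3, 4], ![1, 1, 1, 1, 2, 2, 4],
        ![1, 1, 1, 1, 2, 3, 3], ![1, 1, 1, 2, 2, 2, 3], ![1, 1, 1, 1, 3, 3, 5],
        ![1, 1, 2, 2, 3, 3, 6], ![1, 1, 2, 2, 4, 5, 5], ![1, 1, 1, 3, 4, 6, 8],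
        ![1, 1, 2, 3, 3, 6, 8], ![1, 1, 3, 3, 4, 4, 8], ![1, 2, 3, 3, 3, 4, 8],
        ![1, 2, 3, 3, 5, 6, 10], ![2, 2, 3, 3, 5, 5, 10], ![1, 3, 4, 5, 12, 15, 20]] := by
  classical
  have hh0 : 0 < h := by
    rw [hh]; exact Finset.sum_pos (fun i _ => hpos i) Finset.univ_nonempty
  let σ : Equiv.Perm (Fin 7) := Tuple.sort lam
  have hmono : Monotone (lam ∘ σ) := Tuple.monotone_sort lam
  let A : List ℕ := List.ofFn fun i => h / lam (σ i)
  have hfloor (k : ℕ) : floorSum k A = ∑ i, k / (h / lam i) := by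
    rw [floorSum_eq_sum, List.map_ofFn, List.sum_ofFn]
    exact Equiv.sum_comp σ fun i => k / (h / lam i)
  have hAdvd : ∀ a ∈ A, a ∣ h := by
    simp only [A, List.forall_mem_ofFn_iff]
    exact fun i => Nat.div_dvd_of_dvd (hdvd _)
  have hdd (i : Fin 7) : h / (h / lam i) = lam i := Nat.div_div_self (hdvd i) hh0.ne'
  have hfloorh : floorSum h A = h := by
    rw [hfloor, Finset.sum_congr rfl fun i _ => hdd i, ← hh]
  have hle (k : ℕ) (h2 : 2 ≤ k) (hk : k + 2 ≤ h) : floorSum k A + 2 ≤ k := by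
    have h₁ := (hterm k (by omega) (by omega)).1
    have h₂ := sum_fract_add_sum_div hh hh0 hdvd k
    rw [← hfloor] at h₂
    have : ((floorSum k A + 2 : ℕ) : ℚ) ≤ k := by push_cast; linarith
    exact_mod_cast this
  have hA : IsTerminalList h (A.reverse.reverse ++ []) := by
    rw [List.reverse_reverse, List.append_nil]
    refine ⟨hh0, hAdvd, hle, fun j hj => ?_⟩
    rcases Nat.eq_zero_or_pos j with rfl | hj0
    · omega
    have h₁ := floorSum_sub_succ hAdvd (show j < h by omega)
    have h₂ := hle (h - (j + 1)) (by omega) (by omega)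
    rw [hfloorh, show A.length = 7 by simp [A]] at h₁
    omega
  have hsorted : A.reverse.Pairwise (· ≤ ·) := by
    rw [List.pairwise_reverse, List.pairwise_ofFn]
    exact fun i j hij => Nat.div_le_div_left (hmono hij.le) (hpos _)
  have hfloorr : floorSum h A.reverse = h := by
    have := floorSum_reverse_append h A []
    rw [List.append_nil] at this
    rw [this, hfloorh]
    rfl
  obtain ⟨M, hM, hAM, hmem⟩ := search_sound A.reverse [] 1 1 hA (one_dvd h) (by simp) hsorted
    (fun b hb => Nat.pos_of_dvd_of_pos (hAdvd b (by simpa using hb)) hh0)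
    (by rw [hfloorr]) (by simpa [A] using search_eq_true)
  rw [List.reverse_reverse, List.append_nil] at hAM hmem
  have hMh : M = h := by
    obtain ⟨c, rfl⟩ := hM
    have hc : c ∣ Finset.univ.gcd lam := by
      refine Finset.dvd_gcd fun i _ => ?_
      obtain ⟨d, hd⟩ := hAM (M * c / lam i) (by
        simp only [A, List.mem_ofFn]
        exact ⟨σ.symm i, by simp⟩)
      have hq : 0 < M * c / lam i := Nat.div_pos (Nat.le_of_dvd hh0 (hdvd i)) (hpos i)
      refine ⟨d, Nat.eq_of_mul_eq_mul_left hq ?_⟩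
      rw [Nat.div_mul_cancel (hdvd i), mul_left_comm, ← hd, mul_comm]
    rw [hgcd, Nat.dvd_one] at hc
    rw [hc, mul_one]
  refine ⟨σ, (List.mem_map_of_injective List.ofFn_injective).1 ?_⟩
  rw [hMh, List.map_ofFn] at hmem
  have : ((h / ·) ∘ fun i => h / lam (σ i)) = fun i => lam (σ i) := funext fun i => hdd (σ i)
  rwa [this] at hmem
end
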